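/- Let s = (s_j)_{j=0}^ℓ be a real sequence with s_0 = ⋯ = s_{ν−2} = 0 and s_{ν−1} ≠ 0 (ℓ ≥ 2ν−1), let m(z) = m_{ν−1}z^{ν−1} + ⋯ + m_0 be the polynomial of degree ν−1 associated with s, let (𝔰_i)_{i=−1}^{ℓ−2ν} be the unique reals satisfying T(m_{ν−1}, …, m_0, −𝔰_{−1}, …, −𝔰_{ℓ−2ν}) · T(s_{ν−1}, …, s_ℓ) = I_{ℓ−ν+2}, and set 𝒮_p^− = (𝔰_{i+j−1})_{i,j=0}^{p−1} and n = ⌊ℓ/2⌋. Then: ν_0(𝒮_p^−) = ν_0(S_{p+ν−1}^+) for p = 1, …, n−ν+1; if ν ≥ 2 (i.e. s_0 = 0), then ν_±(𝒮_p^−) = ν_±(S_{p+ν−1}^+) − ν_±(S_{ν−1}^+) for p = 1, …, n−ν+1; and if ν = 1 (i.e. s_0 ≠ 0), then ν_±(𝒮_p^−) = ν_±(S_p^+) for p = 1, …, n. -/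

import Mathlib

open Filter Polynomial Matrix Complex Finset

noncomputable section

/-- Upper triangular Toeplitz matrix `T(c_0,…,c_{n-1})`. -/
def toeplitzU {n : ℕ} (c : Fin n → ℝ) : Matrix (Fin n) (Fin n) ℝ :=
  Matrix.of fun i j =>
    if (i : ℕ) ≤ (j : ℕ) then c ⟨(j : ℕ) - (i : ℕ), lt_of_le_of_lt (Nat.sub_le _ _) j.isLt⟩
    else 0

/-- Hankel matrix `S_n = (s_{i+j})_{i,j=0}^{n-1}`. -/
def hankelM (s : ℕ → ℝ) (n : ℕ) : Matrix (Fin n) (Fin n) ℝ :=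
  Matrix.of fun i j => s ((i : ℕ) + (j : ℕ))

/-- Shifted Hankel matrix `S_n^+ = (s_{i+j+1})_{i,j=0}^{n-1}`. -/
def hankelMp (s : ℕ → ℝ) (n : ℕ) : Matrix (Fin n) (Fin n) ℝ :=
  Matrix.of fun i j => s ((i : ℕ) + (j : ℕ) + 1)

/-- Number of negative eigenvalues (with multiplicity), as roots of the char. polynomial. -/
def nuNeg {n : ℕ} (A : Matrix (Fin n) (Fin n) ℝ) : ℕ :=
  Multiset.card (A.charpoly.roots.filter (fun x => x < 0))

def nuPos {n : ℕ} (A : Matrix (Fin n) (Fin n) ℝ) : ℕ :=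
  Multiset.card (A.charpoly.roots.filter (fun x => 0 < x))

def nuZero {n : ℕ} (A : Matrix (Fin n) (Fin n) ℝ) : ℕ :=
  Multiset.card (A.charpoly.roots.filter (fun x => x = 0))

/-- Determinant of the matrix with rows `(t_i, …, t_{i+ν})` and last row `(1, z, …, z^ν)`. -/
def detRow (t : ℕ → ℝ) (ν : ℕ) : Polynomial ℝ :=
  Matrix.det (Matrix.of fun i j : Fin (ν + 1) =>
    if (i : ℕ) < ν then Polynomial.C (t ((i : ℕ) + (j : ℕ))) else Polynomial.X ^ (j : ℕ))

/-- The polynomial `a(z)` associated with a sequence `s`. -/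
def aPoly (s : ℕ → ℝ) (ν : ℕ) : Polynomial ℝ :=
  Polynomial.C (Matrix.det (hankelM s ν))⁻¹ * detRow s ν

/-- The polynomial `m(z) = (a(z) - a(0))/(b z)` of degree `ν - 1` associated with `s`. -/
def mPoly (s : ℕ → ℝ) (ν : ℕ) : Polynomial ℝ :=
  Polynomial.C (s (ν - 1))⁻¹ * (aPoly s ν - Polynomial.C ((aPoly s ν).eval 0)).divX

section SignatureOfMatrix

variable {n : Type*} [Fintype n] [DecidableEq n]

/-- Congruent real matrices define equivalent quadratic forms. -/
theorem toQuadraticForm'_equivalent_of_congruent {A P : Matrix n n ℝ} (hP : IsUnit P.det) :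
    QuadraticMap.Equivalent (P * A * Pᵀ).toQuadraticForm' A.toQuadraticForm' := by
  have hPt : IsUnit Pᵀ := by
    rw [Matrix.isUnit_iff_isUnit_det, Matrix.det_transpose]
    exact hP
  refine ⟨⟨Matrix.toLinearEquiv' Pᵀ hPt.invertible, fun v => ?_⟩⟩
  change A.toQuadraticForm' (Pᵀ *ᵥ v) = _
  simp only [Matrix.toQuadraticForm', LinearMap.BilinMap.toQuadraticMap_apply,
    Matrix.toLinearMap₂'_apply', ← Matrix.mulVec_mulVec]
  rw [Matrix.mulVec_transpose, ← Matrix.dotProduct_mulVec]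

theorem toQuadraticForm'_diagonal (w : n → ℝ) :
    (Matrix.diagonal w).toQuadraticForm' = QuadraticMap.weightedSumSquares ℝ w := by
  ext v
  simp only [Matrix.toQuadraticForm', LinearMap.BilinMap.toQuadraticMap_apply,
    Matrix.toLinearMap₂'_apply', QuadraticMap.weightedSumSquares_apply, dotProduct,
    Matrix.mulVec_diagonal, smul_eq_mul]
  exact Finset.sum_congr rfl fun i _ => by ring

theorem Matrix.IsHermitian.toQuadraticForm'_equivalent_weightedSumSquares
    {A : Matrix n n ℝ} (hA : A.IsHermitian) :
    QuadraticMap.Equivalent A.toQuadraticForm'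
      (QuadraticMap.weightedSumSquares ℝ hA.eigenvalues) := by
  have h : A = (hA.eigenvectorUnitary : Matrix n n ℝ) * Matrix.diagonal hA.eigenvalues *
      star (hA.eigenvectorUnitary : Matrix n n ℝ) := hA.spectral_theorem
  have hU : IsUnit (hA.eigenvectorUnitary : Matrix n n ℝ).det :=
    (Matrix.isUnit_iff_isUnit_det _).1 (Unitary.isUnit_coe)
  have h2 := toQuadraticForm'_equivalent_of_congruent (A := Matrix.diagonal hA.eigenvalues) hU
  rw [toQuadraticForm'_diagonal] at h2
  rwa [← Matrix.conjTranspose_eq_transpose_of_trivial, ← Matrix.star_eq_conjTranspose,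
    ← h] at h2

theorem Matrix.IsHermitian.card_filter_roots_charpoly {A : Matrix n n ℝ} (hA : A.IsHermitian)
    (q : ℝ → Prop) [DecidablePred q] :
    Multiset.card (A.charpoly.roots.filter q) = {i | q (hA.eigenvalues i)}.ncard := by
  rw [hA.roots_charpoly_eq_eigenvalues, Multiset.filter_map, Multiset.card_map,
    Set.ncard_eq_toFinset_card']
  simp only [Set.toFinset_ofPred]
  rfl

theorem Matrix.IsHermitian.card_pos_roots_charpoly {A : Matrix n n ℝ} (hA : A.IsHermitian) :
    Multiset.card (A.charpoly.roots.filter fun x => 0 < x) = sigPos A.toQuadraticForm' := by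
  rw [hA.card_filter_roots_charpoly, QuadraticForm.sigPos_of_equiv_weightedSumSquares
    hA.toQuadraticForm'_equivalent_weightedSumSquares]

theorem Matrix.IsHermitian.card_neg_roots_charpoly {A : Matrix n n ℝ} (hA : A.IsHermitian) :
    Multiset.card (A.charpoly.roots.filter fun x => x < 0) = sigNeg A.toQuadraticForm' := by
  rw [hA.card_filter_roots_charpoly, QuadraticForm.sigNeg_of_equiv_weightedSumSquares
    hA.toQuadraticForm'_equivalent_weightedSumSquares]

theorem Matrix.IsHermitian.card_roots_charpoly_trichotomy {A : Matrix n n ℝ}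
    (hA : A.IsHermitian) :
    Multiset.card (A.charpoly.roots.filter fun x => x < 0) +
      Multiset.card (A.charpoly.roots.filter fun x => x = 0) +
      Multiset.card (A.charpoly.roots.filter fun x => 0 < x) = Fintype.card n := by
  have h : Multiset.card A.charpoly.roots = Fintype.card n := by
    rw [hA.roots_charpoly_eq_eigenvalues]
    simp
  rw [← h]
  generalize A.charpoly.roots = r
  induction r using Multiset.induction_on with
  | empty => simp
  | cons x r ih =>
    rcases lt_trichotomy x 0 with hx | hx | hx
    · simp [hx, hx.ne, hx.not_gt]
      omega
    · simp [hx]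
      omega
    · simp [hx, hx.ne', hx.not_gt]
      omega

end SignatureOfMatrix

section Inertia

variable {n : ℕ}

theorem nu_congruent {A P : Matrix (Fin n) (Fin n) ℝ} (hA : A.IsHermitian) (hP : IsUnit P.det) :
    nuNeg (P * A * Pᵀ) = nuNeg A ∧ nuZero (P * A * Pᵀ) = nuZero A ∧
      nuPos (P * A * Pᵀ) = nuPos A := by
  have hB : (P * A * Pᵀ).IsHermitian := by
    simpa [Matrix.conjTranspose_eq_transpose_of_trivial] using
      Matrix.isHermitian_mul_mul_conjTranspose P hA
  have e := toQuadraticForm'_equivalent_of_congruent (A := A) hP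
  have hneg : nuNeg (P * A * Pᵀ) = nuNeg A := by
    rw [nuNeg, nuNeg, hA.card_neg_roots_charpoly, hB.card_neg_roots_charpoly, e.sigNeg_eq]
  have hpos : nuPos (P * A * Pᵀ) = nuPos A := by
    rw [nuPos, nuPos, hA.card_pos_roots_charpoly, hB.card_pos_roots_charpoly, e.sigPos_eq]
  have hA3 := hA.card_roots_charpoly_trichotomy
  have hB3 := hB.card_roots_charpoly_trichotomy
  change nuNeg _ + nuZero _ + nuPos _ = _ at hA3 hB3
  omega

theorem nuZero_eq_zero_of_det_ne_zero {A : Matrix (Fin n) (Fin n) ℝ} (hA : A.det ≠ 0) :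
    nuZero A = 0 := by
  rw [nuZero, Multiset.card_eq_zero, Multiset.filter_eq_nil]
  rintro x hx rfl
  have h0 := (Polynomial.mem_roots'.1 hx).2
  rw [Polynomial.IsRoot.def, Matrix.eval_charpoly] at h0
  apply hA
  simpa [Matrix.det_neg] using h0

theorem roots_charpoly_of_block_diagonal {a p : ℕ} {E : Matrix (Fin (a + p)) (Fin (a + p)) ℝ}
    (h₁ : ∀ (i : Fin a) (j : Fin p), E (Fin.castAdd p i) (Fin.natAdd a j) = 0)
    (h₂ : ∀ (i : Fin p) (j : Fin a), E (Fin.natAdd a i) (Fin.castAdd p j) = 0) :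
    E.charpoly.roots =
      (E.submatrix (Fin.castAdd p) (Fin.castAdd p)).charpoly.roots +
        (E.submatrix (Fin.natAdd a) (Fin.natAdd a)).charpoly.roots := by
  have h : Matrix.reindex finSumFinEquiv.symm finSumFinEquiv.symm E =
      Matrix.fromBlocks (E.submatrix (Fin.castAdd p) (Fin.castAdd p)) 0 0
        (E.submatrix (Fin.natAdd a) (Fin.natAdd a)) := by
    ext (i | i) (j | j) <;> simp [h₁, h₂]
  rw [← Matrix.charpoly_reindex finSumFinEquiv.symm E, h, Matrix.charpoly_fromBlocks_zero₁₂,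
    Polynomial.roots_mul]
  exact ((Matrix.charpoly_monic _).mul (Matrix.charpoly_monic _)).ne_zero

end Inertia

section HankelInversion

/-- Entries of `L * S * Lᵀ`, where `L` is the lower triangular Toeplitz matrix of `c` and
`S = (s_{i+j+1})`. -/
def toeplitzHankelEntry (c s : ℕ → ℝ) (i j : ℕ) : ℝ :=
  ∑ l ∈ range (j + 1), c (j - l) * ∑ k ∈ range (i + 1), c (i - k) * s (k + l + 1)

theorem sum_range_mul_shift (c f : ℕ → ℝ) (n : ℕ) :
    ∑ k ∈ range (n + 2), c (n + 1 - k) * f k =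
      c (n + 1) * f 0 + ∑ k ∈ range (n + 1), c (n - k) * f (k + 1) := by
  rw [Finset.sum_range_succ', add_comm]
  simp

theorem toeplitzHankelEntry_zero {a : ℕ} {c s : ℕ → ℝ}
    (hcs : ∀ n, ∑ k ∈ range (n + 1), c (n - k) * s k = if n = a then 1 else 0) (i : ℕ) :
    toeplitzHankelEntry c s i 0 =
      c 0 * (if i + 1 = a then 1 else 0) - c (i + 1) * (if a = 0 then 1 else 0) := by
  have h0 := hcs 0
  have h1 := hcs (i + 1)
  rw [sum_range_mul_shift] at h1
  simp only [zero_add, Finset.sum_range_one, Nat.sub_zero, eq_comm (a := 0)] at h0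
  rw [← h1, ← h0]
  simp only [toeplitzHankelEntry, zero_add, Finset.sum_range_one, Nat.sub_zero, add_zero]
  ring

theorem toeplitzHankelEntry_succ {a : ℕ} {c s : ℕ → ℝ}
    (hcs : ∀ n, ∑ k ∈ range (n + 1), c (n - k) * s k = if n = a then 1 else 0) (i j : ℕ) :
    toeplitzHankelEntry c s i (j + 1) = toeplitzHankelEntry c s (i + 1) j +
      c (j + 1) * (if i + 1 = a then 1 else 0) - c (i + 1) * (if j + 1 = a then 1 else 0) := by
  have hi := hcs (i + 1)
  have hj := hcs (j + 1)
  rw [sum_range_mul_shift] at hi hj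
  rw [← hi, ← hj, toeplitzHankelEntry, toeplitzHankelEntry, sum_range_mul_shift]
  have hrow (l : ℕ) : ∑ k ∈ range (i + 1 + 1), c (i + 1 - k) * s (k + l + 1) =
      c (i + 1) * s (l + 1) + ∑ k ∈ range (i + 1), c (i - k) * s (k + (l + 1) + 1) := by
    rw [sum_range_mul_shift c (fun k => s (k + l + 1))]
    simp only [zero_add]
    congr 1
    exact Finset.sum_congr rfl fun k _ => by rw [show k + 1 + l + 1 = k + (l + 1) + 1 by ring]
  simp only [hrow, mul_add, Finset.sum_add_distrib, Finset.mul_sum, add_zero]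
  have hswap : ∑ l ∈ range (j + 1), c (j - l) * (c (i + 1) * s (l + 1)) =
      ∑ l ∈ range (j + 1), c (i + 1) * (c (j - l) * s (l + 1)) :=
    Finset.sum_congr rfl fun l _ => by ring
  rw [hswap]
  ring

theorem toeplitzHankelEntry_eq {a : ℕ} {c s : ℕ → ℝ}
    (hcs : ∀ n, ∑ k ∈ range (n + 1), c (n - k) * s k = if n = a then 1 else 0) (i j : ℕ) :
    toeplitzHankelEntry c s i j =
      if i < a ∧ j < a ∧ a ≤ i + j + 1 then c (i + j + 1 - a)
      else if a ≤ i ∧ a ≤ j then -c (i + j + 1 - a) else 0 := by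
  induction j generalizing i with
  | zero =>
    rw [toeplitzHankelEntry_zero hcs]
    rcases Nat.eq_zero_or_pos a with rfl | ha
    · simp
    · by_cases h : i + 1 = a
      · subst h
        simp
      · have h1 : ¬ (i < a ∧ 0 < a ∧ a ≤ i + 0 + 1) := by omega
        have h2 : ¬ (a ≤ i ∧ a ≤ 0) := by omega
        rw [if_neg h1, if_neg h2, if_neg h, if_neg ha.ne']
        ring
  | succ j ih =>
    rw [toeplitzHankelEntry_succ hcs, ih, show i + 1 + j + 1 = i + (j + 1) + 1 by ring]
    rcases eq_or_ne (i + 1) a with h1 | h1 <;> rcases eq_or_ne (j + 1) a with h2 | h2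
    · obtain rfl : i = j := by omega
      subst h1
      simp
    · rw [show i + (j + 1) + 1 - a = j + 1 by omega]
      split_ifs <;> first | omega | ring
    · rw [show i + (j + 1) + 1 - a = i + 1 by omega]
      split_ifs <;> first | omega | ring
    · split_ifs <;> first | omega | ring

/-- Lower triangular Toeplitz matrix of a sequence. -/
def toeplitzL (c : ℕ → ℝ) (q : ℕ) : Matrix (Fin q) (Fin q) ℝ :=
  Matrix.of fun i k => if (k : ℕ) ≤ i then c (i - k) else 0

theorem det_toeplitzL (c : ℕ → ℝ) (q : ℕ) : (toeplitzL c q).det = c 0 ^ q := by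
  rw [Matrix.det_of_isLowerTriangular]
  · simp [toeplitzL]
  · intro i j hij
    have : (i : ℕ) < j := hij
    simp only [toeplitzL, Matrix.of_apply]
    exact if_neg this.not_ge

theorem sum_toeplitzL_mul (c : ℕ → ℝ) {q : ℕ} (i : Fin q) (f : ℕ → ℝ) :
    ∑ k : Fin q, toeplitzL c q i k * f k = ∑ k ∈ range (i + 1), c (i - k) * f k := by
  simp only [toeplitzL, Matrix.of_apply]
  rw [Fin.sum_univ_eq_sum_range (fun k => (if k ≤ (i : ℕ) then c (i - k) else 0) * f k) q]
  symm
  have hsub : range ((i : ℕ) + 1) ⊆ range q := Finset.range_subset_range.2 i.isLt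
  rw [← Finset.sum_subset hsub]
  · refine Finset.sum_congr rfl fun k hk => ?_
    rw [if_pos (Nat.lt_succ_iff.1 (Finset.mem_range.1 hk))]
  · intro k _ hk
    rw [if_neg, zero_mul]
    simpa [Nat.lt_succ_iff] using hk

theorem toeplitzL_mul_hankelMp_mul_transpose (c s : ℕ → ℝ) (q : ℕ) :
    toeplitzL c q * hankelMp s q * (toeplitzL c q)ᵀ =
      Matrix.of fun i j : Fin q => toeplitzHankelEntry c s i j := by
  ext i j
  rw [Matrix.mul_apply, Matrix.of_apply, toeplitzHankelEntry, ← sum_toeplitzL_mul c j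
    (fun l => ∑ k ∈ range ((i : ℕ) + 1), c (i - k) * s (k + l + 1))]
  refine Finset.sum_congr rfl fun l _ => ?_
  rw [Matrix.transpose_apply, mul_comm, Matrix.mul_apply, ← sum_toeplitzL_mul c i
    (fun k => s (k + l + 1))]
  rfl

theorem isHermitian_hankelMp (s : ℕ → ℝ) (q : ℕ) : (hankelMp s q).IsHermitian := by
  ext i j
  simp [hankelMp, add_comm]

theorem det_hankelMp_ne_zero {a : ℕ} {s : ℕ → ℝ} (hzero : ∀ j < a, s j = 0) (ha : s a ≠ 0) :
    (hankelMp s a).det ≠ 0 := by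
  have h : (hankelMp s a).submatrix id Fin.revPerm = toeplitzL (fun k => s (a + k)) a := by
    ext i j
    simp only [hankelMp, toeplitzL, Matrix.submatrix_apply, Matrix.of_apply, id,
      Fin.revPerm_apply, Fin.val_rev]
    split_ifs with hij
    · congr 1
      omega
    · exact hzero _ (by omega)
  have hd := Matrix.det_permute' Fin.revPerm (hankelMp s a)
  rw [h, det_toeplitzL] at hd
  intro h0
  rw [h0, mul_zero] at hd
  exact pow_ne_zero a ha hd

/-- If `c` and `s` have convolution `δ_a`, then `S_{a+p}^+` is congruent to the direct sum of a
matrix congruent to `S_a^+` and the Hankel matrix of `-c_{a+1}, -c_{a+2}, …`. -/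
theorem nu_hankelMp_of_convolution {a p : ℕ} {c s f : ℕ → ℝ} (hc : c 0 ≠ 0)
    (hcs : ∀ n, ∑ k ∈ range (n + 1), c (n - k) * s k = if n = a then 1 else 0)
    (hf : ∀ k, k + 1 < 2 * p → f k = -c (a + 1 + k)) :
    nuNeg (hankelMp s (a + p)) = nuNeg (hankelMp s a) + nuNeg (hankelM f p) ∧
      nuZero (hankelMp s (a + p)) = nuZero (hankelMp s a) + nuZero (hankelM f p) ∧
      nuPos (hankelMp s (a + p)) = nuPos (hankelMp s a) + nuPos (hankelM f p) := by
  have hcong (q : ℕ) := nu_congruent (P := toeplitzL c q) (isHermitian_hankelMp s q)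
    (by rw [det_toeplitzL]; exact (pow_ne_zero q hc).isUnit)
  simp only [toeplitzL_mul_hankelMp_mul_transpose] at hcong
  obtain ⟨h₁, h₂, h₃⟩ := hcong (a + p)
  obtain ⟨k₁, k₂, k₃⟩ := hcong a
  rw [← h₁, ← h₂, ← h₃, ← k₁, ← k₂, ← k₃]
  have hblock : (Matrix.of fun i j : Fin (a + p) => toeplitzHankelEntry c s i j).submatrix
      (Fin.natAdd a) (Fin.natAdd a) = hankelM f p := by
    ext i j
    simp only [Matrix.submatrix_apply, Matrix.of_apply, hankelM, toeplitzHankelEntry_eq hcs,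
      Fin.val_natAdd]
    rw [if_neg (by omega), if_pos (by omega), hf _ (by omega)]
    congr 2
    omega
  have hroots := roots_charpoly_of_block_diagonal
    (E := Matrix.of fun i j : Fin (a + p) => toeplitzHankelEntry c s i j)
    (fun i j => by
      simp only [Matrix.of_apply, toeplitzHankelEntry_eq hcs, Fin.val_natAdd, Fin.val_castAdd]
      rw [if_neg (by omega), if_neg (by omega)])
    (fun i j => by
      simp only [Matrix.of_apply, toeplitzHankelEntry_eq hcs, Fin.val_natAdd, Fin.val_castAdd]
      rw [if_neg (by omega), if_neg (by omega)])
  rw [hblock] at hroots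
  simp only [nuNeg, nuZero, nuPos, hroots, Multiset.filter_add, Multiset.card_add]
  exact ⟨rfl, rfl, rfl⟩

theorem sum_mul_toeplitzU {N : ℕ} (d t : ℕ → ℝ)
    (h : toeplitzU (fun i : Fin N => d i) * toeplitzU (fun i : Fin N => t i) = 1)
    {j : ℕ} (hj : j < N) :
    ∑ k ∈ range (j + 1), d k * t (j - k) = if j = 0 then 1 else 0 := by
  have h0 := congrFun (congrFun h ⟨0, by omega⟩) ⟨j, hj⟩
  rw [Matrix.mul_apply, Matrix.one_apply] at h0
  simp only [toeplitzU, Matrix.of_apply, Nat.zero_le, if_true, Nat.sub_zero] at h0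
  rw [Fin.sum_univ_eq_sum_range (fun k => d k * if k ≤ j then t (j - k) else 0) N] at h0
  have hsub : range (j + 1) ⊆ range N := Finset.range_subset_range.2 hj
  rw [← Finset.sum_subset hsub] at h0
  · rw [Finset.sum_congr rfl fun k hk => by
      rw [← if_pos (c := k ≤ j) (t := t (j - k)) (e := 0)
        (Nat.lt_succ_iff.1 (Finset.mem_range.1 hk))], h0]
    simp [Fin.ext_iff, eq_comm]
  · intro k _ hk
    rw [if_neg, mul_zero]
    simpa [Nat.lt_succ_iff] using hk

/-- A truncated convolution inverse extends to a convolution inverse. -/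
theorem exists_convolution_extension {N a : ℕ} {d s : ℕ → ℝ}
    (hzero : ∀ j < a, s j = 0) (ha : s a ≠ 0)
    (hd : ∀ j < N, ∑ k ∈ range (j + 1), d k * s (a + (j - k)) = if j = 0 then 1 else 0) :
    ∃ c : ℕ → ℝ, c 0 ≠ 0 ∧ (∀ k < N, c k = d k) ∧
      ∀ n, ∑ k ∈ range (n + 1), c (n - k) * s k = if n = a then 1 else 0 := by
  set T : PowerSeries ℝ := PowerSeries.mk fun j => s (a + j) with hT
  have hT0 : PowerSeries.constantCoeff T ≠ 0 := by
    rw [← PowerSeries.coeff_zero_eq_constantCoeff_apply]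
    simpa [hT] using ha
  have hinv : T⁻¹ * T = 1 := PowerSeries.inv_mul_cancel T hT0
  refine ⟨fun k => PowerSeries.coeff k T⁻¹, ?_, ?_, ?_⟩
  · simpa using hT0
  · have hdvd : (PowerSeries.X : PowerSeries ℝ) ^ N ∣ PowerSeries.mk d * T - 1 := by
      rw [PowerSeries.X_pow_dvd_iff]
      intro m hm
      rw [map_sub, PowerSeries.coeff_mul, Finset.Nat.sum_antidiagonal_eq_sum_range_succ_mk,
        PowerSeries.coeff_one]
      simp only [hT, PowerSeries.coeff_mk]
      rw [hd m hm, sub_self]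
    have hdvd' : (PowerSeries.X : PowerSeries ℝ) ^ N ∣ T⁻¹ - PowerSeries.mk d := by
      have h : T⁻¹ - PowerSeries.mk d = (PowerSeries.mk d * T - 1) * (-T⁻¹) := by
        linear_combination (PowerSeries.mk d) * hinv
      rw [h]
      exact hdvd.mul_right _
    intro k hk
    have := PowerSeries.X_pow_dvd_iff.1 hdvd' k hk
    rw [map_sub, PowerSeries.coeff_mk] at this
    exact sub_eq_zero.1 this
  · intro n
    have hs : PowerSeries.mk s = PowerSeries.X ^ a * T := by
      ext m
      rw [PowerSeries.coeff_X_pow_mul', PowerSeries.coeff_mk]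
      split_ifs with h
      · simp [hT, Nat.add_sub_cancel' h]
      · exact hzero m (by omega)
    have h : PowerSeries.mk s * T⁻¹ = PowerSeries.X ^ a := by
      rw [hs, mul_assoc, mul_comm T, hinv, mul_one]
    have hn := congrArg (PowerSeries.coeff n) h
    rw [PowerSeries.coeff_mul, Finset.Nat.sum_antidiagonal_eq_sum_range_succ_mk,
      PowerSeries.coeff_X_pow] at hn
    rw [← hn]
    exact Finset.sum_congr rfl fun k _ => by rw [PowerSeries.coeff_mk, mul_comm]

end HankelInversion

/-- Corollary 3.5.  Here the sequence `𝔰_{-1}, 𝔰_0, …, 𝔰_{ℓ-2ν}` is encoded by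
`frak : ℕ → ℝ` with `frak i = 𝔰_{i-1}`; thus `𝒮_p^- = (𝔰_{i+j-1}) = hankelM frak p`.
The equalities `ν_±(𝒮_p^-) = ν_±(S_{p+ν-1}^+) − ν_±(S_{ν-1}^+)` are stated additively. -/
theorem index_identities_for_derived_sequence
    (ℓ ν : ℕ) (hν : 1 ≤ ν) (hℓ : 2 * ν - 1 ≤ ℓ)
    (s : ℕ → ℝ) (hzero : ∀ j, j + 2 ≤ ν → s j = 0) (hsν : s (ν - 1) ≠ 0)
    (frak : ℕ → ℝ)
    (hfrak : toeplitzU (fun i : Fin (ℓ + 2 - ν) =>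
        if (i : ℕ) < ν then (mPoly s ν).coeff (ν - 1 - (i : ℕ)) else -frak ((i : ℕ) - ν)) *
      toeplitzU (fun i : Fin (ℓ + 2 - ν) => s (ν - 1 + (i : ℕ))) = 1) :
    (∀ p : ℕ, 1 ≤ p → p + ν ≤ ℓ / 2 + 1 →
      nuZero (hankelM frak p) = nuZero (hankelMp s (p + ν - 1))) ∧
    (2 ≤ ν → ∀ p : ℕ, 1 ≤ p → p + ν ≤ ℓ / 2 + 1 →
      nuNeg (hankelM frak p) + nuNeg (hankelMp s (ν - 1)) = nuNeg (hankelMp s (p + ν - 1)) ∧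
      nuPos (hankelM frak p) + nuPos (hankelMp s (ν - 1)) = nuPos (hankelMp s (p + ν - 1))) ∧
    (ν = 1 → ∀ p : ℕ, 1 ≤ p → p ≤ ℓ / 2 →
      nuNeg (hankelM frak p) = nuNeg (hankelMp s p) ∧
      nuPos (hankelM frak p) = nuPos (hankelMp s p)) := by
  obtain ⟨a, rfl⟩ : ∃ a, ν = a + 1 := ⟨ν - 1, by omega⟩
  simp only [Nat.add_sub_cancel] at hsν hfrak ⊢
  have hz : ∀ j < a, s j = 0 := fun j hj => hzero j (by omega)
  obtain ⟨c, hc0, hcd, hcs⟩ := exists_convolution_extension hz hsν fun j hj =>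
    sum_mul_toeplitzU (N := ℓ + 2 - (a + 1))
      (fun i => if i < a + 1 then (mPoly s (a + 1)).coeff (a - i) else -frak (i - (a + 1)))
      (fun i => s (a + i)) hfrak hj
  have key (p : ℕ) (hp : p + (a + 1) ≤ ℓ / 2 + 1) :=
    nu_hankelMp_of_convolution (p := p) (f := frak) hc0 hcs fun k hk => by
      rw [hcd _ (by omega), if_neg (by omega), Nat.add_sub_cancel_left, neg_neg]
  have hidx (p : ℕ) : p + (a + 1) - 1 = a + p := by omega
  refine ⟨fun p _ hp => ?_, fun _ p _ hp => ?_, fun ha p _ hp => ?_⟩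
  · rw [hidx, (key p hp).2.1, nuZero_eq_zero_of_det_ne_zero (det_hankelMp_ne_zero hz hsν), zero_add]
  · rw [hidx, (key p hp).1, (key p hp).2.2]
    exact ⟨add_comm _ _, add_comm _ _⟩
  · obtain rfl : a = 0 := by omega
    obtain ⟨h₁, -, h₃⟩ := key p (by omega)
    rw [zero_add] at h₁ h₃
    rw [h₁, h₃]
    simp [nuNeg, nuPos]

end
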